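/- The sum over k >= 0 of (H_{2k} - H_k) * (-1)^k / ((3k+1) * binomial(3k,k) * 4^{k+1}) equals (3/64)·(ln 2)² + (1/16)·arctan²(√7/5) - (5√7/112)·ln 2·arctan(√7/5). -/

import Mathlib

open Real

namespace Aux17

noncomputable def T : ℕ → ℕ → ℝ
  | m, 0 => (harmonic m : ℝ) / (m + 1)
  | m, k + 1 => T m k - T (m + 1) k

lemma harm_succ (n : ℕ) : (harmonic (n + 1) : ℝ) = harmonic n + 1 / ((n : ℝ) + 1) := by
  rw [harmonic_succ]; push_cast; rw [one_div]

lemma harm_bd (n : ℕ) : 0 ≤ (harmonic n : ℝ) ∧ (harmonic n : ℝ) ≤ n := by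
  induction n with
  | zero => simp
  | succ n ih =>
    rw [harm_succ]
    have h1 : 1 / ((n : ℝ) + 1) ≤ 1 := by
      rw [div_le_one (by positivity)]; linarith [(Nat.cast_nonneg n : (0:ℝ) ≤ n)]
    have h2 : 0 ≤ 1 / ((n : ℝ) + 1) := by positivity
    push_cast
    constructor <;> linarith [ih.1, ih.2]

lemma T_bd (k : ℕ) : ∀ m, |T m k| ≤ 2 ^ k := by
  induction k with
  | zero =>
    intro m
    have := harm_bd m
    rw [T, abs_of_nonneg (div_nonneg this.1 (by positivity)), div_le_iff₀ (by positivity)]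
    simp; linarith
  | succ k ih =>
    intro m
    rw [T, pow_succ]
    have := abs_sub (T m k) (T (m + 1) k)
    linarith [ih m, ih (m + 1)]

lemma T_formula (k : ℕ) : ∀ m, T m k =
    (m.factorial * k.factorial : ℝ) / (m + k + 1).factorial * (harmonic m - harmonic k) := by
  induction k with
  | zero =>
    intro m
    have : (m.factorial : ℝ) ≠ 0 := by positivity
    simp only [T, Nat.factorial_succ, Nat.add_zero, harmonic_zero, Nat.factorial_zero]
    push_cast
    field_simp
    ring
  | succ k ih =>
    intro m
    have e1 : m + (k + 1) + 1 = (m + k + 1) + 1 := by ring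
    have e2 : m + 1 + k + 1 = (m + k + 1) + 1 := by ring
    rw [T, ih, ih, harm_succ, harm_succ, e1, e2, Nat.factorial_succ (m + k + 1),
      Nat.factorial_succ m, Nat.factorial_succ k]
    have h0 : ((m + k + 1).factorial : ℝ) ≠ 0 := by positivity
    have h1 : (m : ℝ) + 1 ≠ 0 := by positivity
    have h2 : (k : ℝ) + 1 ≠ 0 := by positivity
    have h3 : (m : ℝ) + k + 1 + 1 ≠ 0 := by positivity
    push_cast
    field_simp
    ring

lemma term_eq (k : ℕ) : ((harmonic (2 * k) : ℝ) - (harmonic k : ℝ)) * (-1) ^ k /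
        ((3 * k + 1) * (Nat.choose (3 * k) k : ℝ) * 4 ^ (k + 1)) =
        (-1) ^ k / 4 ^ (k + 1) * T (2 * k) k := by
  rw [T_formula, Nat.cast_choose ℝ (by omega : k ≤ 3 * k)]
  have e : 3 * k - k = 2 * k := by omega
  have e' : 2 * k + k + 1 = 3 * k + 1 := by ring
  rw [e, e', Nat.factorial_succ]
  have h0 : ((3 * k).factorial : ℝ) ≠ 0 := by positivity
  have h1 : ((2 * k).factorial : ℝ) ≠ 0 := by positivity
  have h2 : ((k).factorial : ℝ) ≠ 0 := by positivity
  have h3 : (3 * k : ℝ) + 1 ≠ 0 := by positivity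
  push_cast
  field_simp

lemma summ (z : ℂ) (hz : ‖z‖ < 1) (f : ℕ → ℝ) (C : ℝ) (hf : ∀ n, |f n| ≤ C) (j : ℕ) :
    Summable (fun n => z ^ (n + j) * (f n : ℂ)) := by
  have hC : 0 ≤ C := (abs_nonneg _).trans (hf 0)
  refine Summable.of_norm_bounded (g := fun n => ‖z‖ ^ n * C)
    ((summable_geometric_of_lt_one (norm_nonneg z) hz).mul_right C) fun n => ?_
  rw [norm_mul, norm_pow, Complex.norm_real, Real.norm_eq_abs]
  exact mul_le_mul (pow_le_pow_of_le_one (norm_nonneg z) hz.le (by omega)) (hf n)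
    (abs_nonneg _) (by positivity)

lemma key (z : ℂ) (hz : ‖z‖ < 1) (h : 4 * z ^ 3 + z - 1 = 0) (f : ℕ → ℝ) (C : ℝ)
    (hf : ∀ n, |f n| ≤ C) :
    4 * ∑' n, z ^ (n + 3) * (f n : ℂ) + ∑' n, z ^ (n + 3) * ((f (n + 2) - f (n + 3) : ℝ) : ℂ)
      = (1 - z) * (f 0 + z * f 1) + z ^ 2 * f 2 := by
  have s0 := summ z hz f C hf 0
  have h2 := s0.sum_add_tsum_nat_add 2
  have h3 := s0.sum_add_tsum_nat_add 3
  have s2 := summ z hz (fun n => f (n + 2)) C (fun n => hf _) 3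
  have s3 := summ z hz (fun n => f (n + 3)) C (fun n => hf _) 3
  have e1 : ∑' n, z ^ (n + 3) * ((f (n + 2) - f (n + 3) : ℝ) : ℂ)
      = ∑' n, z ^ (n + 3) * (f (n + 2) : ℂ) - ∑' n, z ^ (n + 3) * (f (n + 3) : ℂ) := by
    rw [← s2.tsum_sub s3]
    congr 1; ext n; push_cast; ring
  have e2 : ∑' n, z ^ (n + 3) * (f n : ℂ) = z ^ 3 * ∑' n, z ^ (n + 0) * (f n : ℂ) := by
    rw [← tsum_mul_left]; congr 1; ext n; ring
  have e3 : ∑' n, z ^ (n + 3) * (f (n + 2) : ℂ)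
      = z * ∑' n, z ^ (n + 2 + 0) * (f (n + 2) : ℂ) := by
    rw [← tsum_mul_left]; congr 1; ext n; ring
  rw [e1, e2, e3]
  simp only [Finset.sum_range_succ, Finset.sum_range_zero] at h2 h3
  simp only [add_zero] at h2 h3 ⊢
  linear_combination z * h2 - h3 + (∑' n, z ^ n * (f n : ℂ)) * h

lemma logsq (z : ℂ) (hz : ‖z‖ < 1) :
    ∑' n, z ^ (n + 3) * (T n 0 : ℂ) = z ^ 2 * (Complex.log (1 - z) ^ 2 / 2) := by
  have hl : HasSum (fun n : ℕ => z ^ (n + 1) / ((n : ℂ) + 1)) (-Complex.log (1 - z)) := by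
    have := (hasSum_nat_add_iff' 1).mpr (Complex.hasSum_taylorSeries_neg_log hz)
    simpa using this
  have hn : Summable (fun n : ℕ => ‖z ^ (n + 1) / ((n : ℂ) + 1)‖) := hl.summable.norm
  have hp := tsum_mul_tsum_eq_tsum_sum_antidiagonal_of_summable_norm hn hn
  rw [hl.tsum_eq] at hp
  have hanti : ∀ n : ℕ, ∑ x ∈ Finset.HasAntidiagonal.antidiagonal n, (z ^ (x.1 + 1) / ((x.1 : ℂ) + 1)) *
      (z ^ (x.2 + 1) / ((x.2 : ℂ) + 1)) = 2 * (z ^ (n + 2) * (T (n + 1) 0 : ℂ)) := by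
    intro n
    have hh : ∑ x ∈ Finset.HasAntidiagonal.antidiagonal n, 1 / ((x.1 : ℂ) + 1) = ((harmonic (n + 1) : ℝ) : ℂ) := by
      rw [Finset.Nat.sum_antidiagonal_eq_sum_range_succ_mk, harmonic]
      push_cast
      simp
    have hh' : ∑ x ∈ Finset.HasAntidiagonal.antidiagonal n, 1 / ((x.2 : ℂ) + 1) = ((harmonic (n + 1) : ℝ) : ℂ) := by
      rw [← hh, ← Finset.Nat.sum_antidiagonal_swap]
      rfl
    have : ∀ x ∈ Finset.HasAntidiagonal.antidiagonal n, (z ^ (x.1 + 1) / ((x.1 : ℂ) + 1)) *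
      (z ^ (x.2 + 1) / ((x.2 : ℂ) + 1)) =
        z ^ (n + 2) / (n + 2) * (1 / ((x.1 : ℂ) + 1) + 1 / ((x.2 : ℂ) + 1)) := by
      rintro ⟨i, j⟩ hx
      have hx := Finset.HasAntidiagonal.mem_antidiagonal.mp hx
      simp only at hx
      subst hx
      have h1 : (i : ℂ) + 1 ≠ 0 := by exact_mod_cast Nat.succ_ne_zero i
      have h2 : (j : ℂ) + 1 ≠ 0 := by exact_mod_cast Nat.succ_ne_zero j
      have h3 : (i : ℂ) + j + 2 ≠ 0 := by exact_mod_cast Nat.succ_ne_zero (i + j + 1)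
      push_cast
      field_simp
      ring
    rw [Finset.sum_congr rfl this, ← Finset.mul_sum, Finset.sum_add_distrib, hh, hh', T]
    have h3 : (n : ℂ) + 2 ≠ 0 := by exact_mod_cast Nat.succ_ne_zero (n + 1)
    have h4 : (n : ℂ) + 1 + 1 ≠ 0 := by exact_mod_cast Nat.succ_ne_zero (n + 1)
    push_cast
    field_simp
    ring
  simp only [hanti] at hp
  rw [tsum_mul_left] at hp
  have s0 := summ z hz (fun n => T n 0) 1 (fun n => by simpa using T_bd 0 n) 1
  have h1 := s0.sum_add_tsum_nat_add 1
  have e2 : ∑' n, z ^ (n + 3) * (T n 0 : ℂ) = z ^ 2 * ∑' n, z ^ (n + 1) * (T n 0 : ℂ) := by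
    rw [← tsum_mul_left]; congr 1; ext n; ring
  rw [e2, ← h1]
  simp only [Finset.sum_range_one, T, harmonic_zero]
  simp only [T] at hp
  push_cast at hp ⊢
  linear_combination -(z ^ 2 / 2) * hp

noncomputable def s : ℂ := Complex.I * (√7 : ℝ)

lemma s_sq : s ^ 2 = -7 := by
  rw [s, mul_pow, Complex.I_sq, ← Complex.ofReal_pow, Real.sq_sqrt (by norm_num)]
  norm_num

noncomputable def zp : ℂ := (-1 + s) / 4
noncomputable def zm : ℂ := (-1 - s) / 4

lemma zp_norm : ‖zp‖ < 1 := by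
  have : ‖zp‖ ^ 2 = 1 / 2 := by
    rw [← Complex.normSq_eq_norm_sq, Complex.normSq_apply]
    simp [zp, s]
    have := Real.sq_sqrt (show (0:ℝ) ≤ 7 by norm_num)
    nlinarith
  nlinarith [norm_nonneg zp]

lemma zm_norm : ‖zm‖ < 1 := by
  have : ‖zm‖ ^ 2 = 1 / 2 := by
    rw [← Complex.normSq_eq_norm_sq, Complex.normSq_apply]
    simp [zm, s]
    have := Real.sq_sqrt (show (0:ℝ) ≤ 7 by norm_num)
    nlinarith
  nlinarith [norm_nonneg zm]

lemma half_norm : ‖(1 / 2 : ℂ)‖ < 1 := by norm_num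

noncomputable def θ : ℝ := Real.arctan (√7 / 5)

lemma log_aux (ε : ℝ) (hε : ε = 1 ∨ ε = -1) :
    Complex.log ((5 + ε * s) / 4) = Real.log 2 / 2 + ε * θ * Complex.I := by
  have hb := Real.arctan_lt_pi_div_two (√7 / 5)
  have hb' := Real.neg_pi_div_two_lt_arctan (√7 / 5)
  have hpi := Real.pi_pos
  have him : ((Real.log 2 / 2 + ε * θ * Complex.I : ℂ)).im = ε * θ := by
    rw [← Complex.ofReal_ofNat 2, ← Complex.ofReal_div]
    simp [-Complex.ofReal_div, -Complex.ofReal_log, -Complex.ofReal_ofNat]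
  rw [← Complex.log_exp (x := (Real.log 2 / 2 + ε * θ * Complex.I : ℂ))]
  · congr 1
    have h7 := Real.sq_sqrt (show (0:ℝ) ≤ 7 by norm_num)
    have hden : √(1 + (√7 / 5) ^ 2) = 4 * √2 / 5 := by
      rw [Real.sqrt_eq_iff_mul_self_eq (by positivity) (by positivity)]
      have := Real.sq_sqrt (show (0:ℝ) ≤ 2 by norm_num)
      nlinarith
    have h2 := Real.sq_sqrt (show (0:ℝ) ≤ 2 by norm_num)
    have hs2 : √2 ≠ 0 := by positivity
    have hc : Real.cos θ = 5 / (4 * √2) := by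
      rw [θ, Real.cos_arctan, hden]; field_simp
    have hs : Real.sin θ = √7 / (4 * √2) := by
      rw [θ, Real.sin_arctan, hden]; field_simp
    have hexp : Complex.exp (Real.log 2 / 2) = (√2 : ℝ) := by
      rw [Real.sqrt_eq_rpow, Real.rpow_def_of_pos (by norm_num)]
      push_cast; congr 1; ring
    have hce : Real.cos (ε * θ) = 5 / (4 * √2) := by
      rcases hε with rfl | rfl <;> simp [hc]
    have hse : Real.sin (ε * θ) = ε * (√7 / (4 * √2)) := by
      rcases hε with rfl | rfl <;> simp [hs]
    rw [Complex.exp_add, hexp, ← Complex.ofReal_mul, Complex.exp_mul_I, ← Complex.ofReal_cos,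
      ← Complex.ofReal_sin, hce, hse, s]
    have hs2' : ((√2 : ℝ) : ℂ) ≠ 0 := by exact_mod_cast hs2
    push_cast
    field_simp
  · rw [him]; rcases hε with rfl | rfl <;> unfold θ <;> linarith
  · rw [him]; rcases hε with rfl | rfl <;> unfold θ <;> linarith

/-- The combined functional. -/
noncomputable def U (f : ℕ → ℝ) : ℂ :=
  1 / 2 * ∑' n, (1 / 2 : ℂ) ^ (n + 3) * (f n : ℂ) +
  (7 + s) / 28 * ∑' n, zp ^ (n + 3) * (f n : ℂ) +
  (7 - s) / 28 * ∑' n, zm ^ (n + 3) * (f n : ℂ)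

lemma U_rec (f : ℕ → ℝ) (C : ℝ) (hf : ∀ n, |f n| ≤ C) :
    4 * U f + U (fun n => f (n + 2) - f (n + 3)) = f 0 := by
  have hs := s_sq
  have k1 := key (1 / 2) half_norm (by norm_num) f C hf
  have k2 := key zp zp_norm (by unfold zp; linear_combination (-3 + s) / 16 * hs) f C hf
  have k3 := key zm zm_norm (by unfold zm; linear_combination (-3 - s) / 16 * hs) f C hf
  unfold U
  have : ∀ a b c : ℂ, 1 / 2 * ((1 - 1 / 2) * (a + 1 / 2 * b) + (1 / 2) ^ 2 * c) +
    (7 + s) / 28 * ((1 - zp) * (a + zp * b) + zp ^ 2 * c) +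
    (7 - s) / 28 * ((1 - zm) * (a + zm * b) + zm ^ 2 * c) = a := by
    intro a b c
    unfold zp zm
    have h3 : s ^ 3 = -7 * s := by rw [pow_succ, hs]
    ring_nf
    simp only [hs, h3]
    ring
  linear_combination 1 / 2 * k1 + (7 + s) / 28 * k2 + (7 - s) / 28 * k3 + this (f 0) (f 1) (f 2)

lemma tsum_bd (z : ℂ) (hz : ‖z‖ < 1) (f : ℕ → ℝ) (C : ℝ) (hf : ∀ n, |f n| ≤ C) :
    ‖∑' n, z ^ (n + 3) * (f n : ℂ)‖ ≤ (1 - ‖z‖)⁻¹ * C := by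
  have hC : 0 ≤ C := (abs_nonneg _).trans (hf 0)
  refine tsum_of_norm_bounded (g := fun n => ‖z‖ ^ n * C)
    ((hasSum_geometric_of_lt_one (norm_nonneg z) hz).mul_right C) fun n => ?_
  rw [norm_mul, norm_pow, Complex.norm_real, Real.norm_eq_abs]
  exact mul_le_mul (pow_le_pow_of_le_one (norm_nonneg z) hz.le (by omega)) (hf n)
    (abs_nonneg _) (by positivity)

lemma U_bd : ∃ D : ℝ, ∀ (f : ℕ → ℝ) (C : ℝ), (∀ n, |f n| ≤ C) → ‖U f‖ ≤ D * C := by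
  refine ⟨‖(1 / 2 : ℂ)‖ * (1 - ‖(1 / 2 : ℂ)‖)⁻¹ + ‖(7 + s) / 28‖ * (1 - ‖zp‖)⁻¹ +
    ‖(7 - s) / 28‖ * (1 - ‖zm‖)⁻¹, fun f C hf => ?_⟩
  unfold U
  refine (norm_add₃_le).trans ?_
  rw [norm_mul, norm_mul, norm_mul, add_mul, add_mul, mul_assoc, mul_assoc, mul_assoc]
  gcongr
  · exact tsum_bd _ half_norm f C hf
  · exact tsum_bd _ zp_norm f C hf
  · exact tsum_bd _ zm_norm f C hf

lemma U_zero : U (fun n => T n 0) = (((3 / 64) * (Real.log 2) ^ 2 + (1 / 16) * θ ^ 2 -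
        (5 * Real.sqrt 7 / 112) * Real.log 2 * θ : ℝ) : ℂ) := by
  unfold U
  rw [logsq _ half_norm, logsq _ zp_norm, logsq _ zm_norm]
  have l1 : Complex.log (1 - 1 / 2) = -(Real.log 2 : ℝ) := by
    rw [show (1 - 1 / 2 : ℂ) = ((1 / 2 : ℝ) : ℂ) by push_cast; norm_num,
      ← Complex.ofReal_log (by norm_num), one_div, Real.log_inv]
    push_cast; rfl
  have l2 : Complex.log (1 - zp) = Real.log 2 / 2 - θ * Complex.I := by
    have := log_aux (-1) (Or.inr rfl)
    rw [show 1 - zp = (5 + ((-1 : ℝ) : ℂ) * s) / 4 by unfold zp; push_cast; ring, this]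
    push_cast; ring
  have l3 : Complex.log (1 - zm) = Real.log 2 / 2 + θ * Complex.I := by
    have := log_aux 1 (Or.inl rfl)
    rw [show 1 - zm = (5 + ((1 : ℝ) : ℂ) * s) / 4 by unfold zm; push_cast; ring, this]
    push_cast; ring
  rw [l1, l2, l3]
  have hs := s_sq
  have h3 : s ^ 3 = -7 * s := by rw [pow_succ, hs]
  have hI : s * Complex.I = -(√7 : ℝ) := by
    rw [s]; linear_combination ((√7 : ℝ) : ℂ) * Complex.I_sq
  unfold zp zm
  push_cast
  generalize (Real.log 2 : ℂ) = L
  generalize (θ : ℂ) = t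
  have hr : ((√7 : ℝ) : ℂ) = -(s * Complex.I) := by rw [hI]; ring
  rw [hr]
  have hI2 := Complex.I_sq
  ring_nf
  simp only [hs, h3, hI2]
  ring

lemma partial_sum (N : ℕ) : (((∑ k ∈ Finset.range N, (-1) ^ k / 4 ^ (k + 1) * T (2 * k) k) : ℝ) : ℂ)
    = U (fun n => T n 0) - (-1 / 4) ^ N * U (fun n => T (n + 2 * N) N) := by
  induction N with
  | zero => simp
  | succ N ih =>
    have h := U_rec (fun n => T (n + 2 * N) N) (2 ^ N) (fun n => T_bd _ _)
    have e : (fun n => T (n + 2 + 2 * N) N - T (n + 3 + 2 * N) N)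
        = fun n => T (n + 2 * (N + 1)) (N + 1) := by
      ext n
      rw [T]
      congr 2 <;> ring_nf
    simp only [e, zero_add] at h
    rw [Finset.sum_range_succ, Complex.ofReal_add, ih]
    push_cast
    rw [← h, pow_succ (-1 / 4 : ℂ), pow_succ (4 : ℂ), div_pow]
    have h4 : (4 : ℂ) ^ N ≠ 0 := pow_ne_zero _ (by norm_num)
    field_simp
    ring

lemma summable_T : Summable (fun k : ℕ => (-1 : ℝ) ^ k / 4 ^ (k + 1) * T (2 * k) k) := by
  refine Summable.of_norm_bounded (g := fun k : ℕ => (1 / 2 : ℝ) ^ k)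
    (summable_geometric_of_lt_one (by norm_num) (by norm_num)) fun k => ?_
  have := T_bd k (2 * k)
  rw [norm_mul, norm_div, norm_pow, norm_pow, norm_neg, norm_one, one_pow, Real.norm_eq_abs,
    Real.norm_eq_abs, abs_of_pos (by norm_num : (0:ℝ) < 4)]
  calc 1 / (4 : ℝ) ^ (k + 1) * |T (2 * k) k| ≤ 1 / (4 : ℝ) ^ k * 2 ^ k := by
        gcongr
        · norm_num
        · omega
    _ = (1 / 2) ^ k := by
        rw [show (4 : ℝ) = 2 * 2 by norm_num, mul_pow, div_pow, one_pow]
        field_simp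

end Aux17

open Aux17 in
theorem stmt_17 :
    ∑' k : ℕ, ((harmonic (2 * k) : ℝ) - (harmonic k : ℝ)) * (-1) ^ k /
        ((3 * k + 1) * (Nat.choose (3 * k) k : ℝ) * 4 ^ (k + 1)) =
      (3 / 64) * (Real.log 2) ^ 2 + (1 / 16) * (Real.arctan (Real.sqrt 7 / 5)) ^ 2 -
        (5 * Real.sqrt 7 / 112) * Real.log 2 * Real.arctan (Real.sqrt 7 / 5) := by
  simp only [term_eq]
  have h1 := summable_T.hasSum.tendsto_sum_nat
  have h2 := (Complex.continuous_ofReal.tendsto _).comp h1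
  have h3 : Filter.Tendsto (fun N : ℕ => (-1 / 4 : ℂ) ^ N * U (fun n => T (n + 2 * N) N))
      Filter.atTop (nhds 0) := by
    obtain ⟨D, hD⟩ := U_bd
    have hg : Filter.Tendsto (fun N : ℕ => D * (1 / 2 : ℝ) ^ N) Filter.atTop (nhds 0) := by
      simpa using (tendsto_pow_atTop_nhds_zero_of_lt_one (r := (1 / 2 : ℝ)) (by norm_num)
        (by norm_num)).const_mul D
    refine squeeze_zero_norm (fun N => ?_) hg
    have := hD (fun n => T (n + 2 * N) N) (2 ^ N) (fun n => T_bd _ _)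
    rw [norm_mul, norm_pow]
    have e : ‖(-1 / 4 : ℂ)‖ = 1 / 4 := by norm_num
    rw [e]
    calc (1 / 4 : ℝ) ^ N * ‖U (fun n => T (n + 2 * N) N)‖ ≤ (1 / 4 : ℝ) ^ N * (D * 2 ^ N) := by
          gcongr
      _ = D * (1 / 2) ^ N := by
          rw [show (1 / 2 : ℝ) = 1 / 4 * 2 by norm_num, mul_pow]; ring
  have h4 := h3.const_sub (U (fun n => T n 0))
  rw [sub_zero] at h4
  have h5 : (fun N : ℕ => U (fun n => T n 0) - (-1 / 4 : ℂ) ^ N * U (fun n => T (n + 2 * N) N))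
      = Complex.ofReal ∘ fun N => ∑ k ∈ Finset.range N, (-1) ^ k / 4 ^ (k + 1) * T (2 * k) k := by
    ext N
    exact (partial_sum N).symm
  rw [h5] at h4
  have h6 := tendsto_nhds_unique h2 h4
  rw [U_zero] at h6
  exact_mod_cast h6
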